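/- Let d ≥ 1, L ≥ 2, Φ ∈ ℝ^{d×d}, and set φ = max{2‖Φ‖_F, 3 L^{−1/2}, 1}. Let W_1(t),…,W_L(t) evolve by discrete gradient descent W_l(t+1) = W_l(t) − η ∇_l R(t) from the zero-asymmetric initialization W_l(0) = I (l = 1,…,L−1), W_L(0) = 0, with learning rate η ≤ min{(4 L³ φ⁶)^{−1}, (144 L² φ⁴)^{−1}}. Then for every iteration t ≥ 0: ‖D_l(t)‖₂ ≤ (2 L³ φ²)^{−1} for l = 1,…,L−2, and ‖I + D_{L−1}(t)‖₂ ≤ (4 L²)^{−1}. -/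

import Mathlib

open Matrix

namespace ZAS

/-- `seg W l₁ l₂ = W l₂ * W (l₂-1) * ⋯ * W l₁` (the empty product, when `l₂ < l₁`, is `1`). -/
noncomputable def seg {d : ℕ} (W : ℕ → Matrix (Fin d) (Fin d) ℝ) (l₁ : ℕ) :
    ℕ → Matrix (Fin d) (Fin d) ℝ
  | 0 => 1
  | (k+1) => if k + 1 < l₁ then 1 else W (k+1) * seg W l₁ k

/-- Squared Frobenius norm `‖A‖_F²`. -/
noncomputable def frobSq {m n : ℕ} (A : Matrix (Fin m) (Fin n) ℝ) : ℝ :=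
  ∑ i, ∑ j, (A i j)^2

/-- Frobenius norm `‖A‖_F`. -/
noncomputable def frob {m n : ℕ} (A : Matrix (Fin m) (Fin n) ℝ) : ℝ :=
  Real.sqrt (frobSq A)

/-- Frobenius inner product `⟨A, B⟩ = tr(Aᵀ B)`. -/
noncomputable def finner {m n : ℕ} (A B : Matrix (Fin m) (Fin n) ℝ) : ℝ :=
  ∑ i, ∑ j, A i j * B i j

/-- The loss `R(W_1, …, W_L) = (1/2) ‖W_{L:1} - Φ‖_F²`. -/
noncomputable def loss {d : ℕ} (W : ℕ → Matrix (Fin d) (Fin d) ℝ)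
    (Φ : Matrix (Fin d) (Fin d) ℝ) (L : ℕ) : ℝ :=
  frobSq (seg W 1 L - Φ) / 2

/-- The gradient `∇_l R = W_{L:l+1}ᵀ (W_{L:1} - Φ) W_{l-1:1}ᵀ`. -/
noncomputable def grad {d : ℕ} (W : ℕ → Matrix (Fin d) (Fin d) ℝ)
    (Φ : Matrix (Fin d) (Fin d) ℝ) (L l : ℕ) : Matrix (Fin d) (Fin d) ℝ :=
  (seg W (l+1) L)ᵀ * (seg W 1 L - Φ) * (seg W 1 (l-1))ᵀ

/-- The invariant matrices `D_l = W_{l+1}ᵀ W_{l+1} - W_l W_lᵀ`. -/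
noncomputable def Dmat {d : ℕ} (W : ℕ → Matrix (Fin d) (Fin d) ℝ) (l : ℕ) :
    Matrix (Fin d) (Fin d) ℝ :=
  (W (l+1))ᵀ * W (l+1) - W l * (W l)ᵀ

/-- Spectral norm (operator 2-norm) of a square real matrix. -/
noncomputable def spec {d : ℕ} (A : Matrix (Fin d) (Fin d) ℝ) : ℝ :=
  ‖Matrix.toEuclideanCLM (𝕜 := ℝ) A‖

/-- The loss on data: `R̃ = (1/2) ‖W_{L:1} X - Y‖_F²`. -/
noncomputable def lossT {d n : ℕ} (W : ℕ → Matrix (Fin d) (Fin d) ℝ)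
    (X Y : Matrix (Fin d) (Fin n) ℝ) (L : ℕ) : ℝ :=
  frobSq (seg W 1 L * X - Y) / 2

/-- The gradient of the data loss: `∇_l R̃ = W_{L:l+1}ᵀ (W_{L:1} X - Y) Xᵀ W_{l-1:1}ᵀ`. -/
noncomputable def gradT {d n : ℕ} (W : ℕ → Matrix (Fin d) (Fin d) ℝ)
    (X Y : Matrix (Fin d) (Fin n) ℝ) (L l : ℕ) : Matrix (Fin d) (Fin d) ℝ :=
  (seg W (l+1) L)ᵀ * (seg W 1 L * X - Y) * Xᵀ * (seg W 1 (l-1))ᵀ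

end ZAS

open ZAS

namespace ZAS

section

open scoped Matrix.Norms.L2Operator

lemma spec_eq_norm {d : ℕ} (A : Matrix (Fin d) (Fin d) ℝ) : spec A = ‖A‖ := rfl

lemma norm_transpose {d : ℕ} (A : Matrix (Fin d) (Fin d) ℝ) : ‖Aᵀ‖ = ‖A‖ := by
  rw [← conjTranspose_eq_transpose_of_trivial, l2_opNorm_conjTranspose]

lemma norm_transpose_mul_self {d : ℕ} (A : Matrix (Fin d) (Fin d) ℝ) : ‖Aᵀ * A‖ = ‖A‖ ^ 2 := by
  rw [← conjTranspose_eq_transpose_of_trivial, l2_opNorm_conjTranspose_mul_self, sq]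

lemma norm_mul_transpose_self {d : ℕ} (A : Matrix (Fin d) (Fin d) ℝ) : ‖A * Aᵀ‖ = ‖A‖ ^ 2 := by
  have h := norm_transpose_mul_self Aᵀ
  rwa [transpose_transpose, norm_transpose] at h

lemma norm_one_le {d : ℕ} : ‖(1 : Matrix (Fin d) (Fin d) ℝ)‖ ≤ 1 := by
  rw [← l2_opNorm_toEuclideanCLM, map_one]
  exact ContinuousLinearMap.norm_id_le

lemma dotProduct_self_eq_norm_sq {d : ℕ} (x : Fin d → ℝ) :
    x ⬝ᵥ x = ‖WithLp.toLp 2 x‖ ^ 2 := by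
  rw [EuclideanSpace.real_norm_sq_eq]
  simp [dotProduct, sq]

lemma dotProduct_mulVec_self_le {d : ℕ} (A : Matrix (Fin d) (Fin d) ℝ) (x : Fin d → ℝ) :
    (A *ᵥ x) ⬝ᵥ (A *ᵥ x) ≤ ‖A‖ ^ 2 * (x ⬝ᵥ x) := by
  rw [dotProduct_self_eq_norm_sq, dotProduct_self_eq_norm_sq, ← mul_pow]
  exact pow_le_pow_left₀ (norm_nonneg _) (l2_opNorm_mulVec A (WithLp.toLp 2 x)) 2

lemma norm_sq_le_of_forall {d : ℕ} (A : Matrix (Fin d) (Fin d) ℝ) {c : ℝ} (hc : 0 ≤ c)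
    (h : ∀ x : Fin d → ℝ, (A *ᵥ x) ⬝ᵥ (A *ᵥ x) ≤ c * (x ⬝ᵥ x)) : ‖A‖ ^ 2 ≤ c := by
  have hA : ‖A‖ ≤ √c := by
    rw [← l2_opNorm_toEuclideanCLM]
    refine ContinuousLinearMap.opNorm_le_bound _ (Real.sqrt_nonneg _) fun x => ?_
    rw [← sq_le_sq₀ (norm_nonneg _) (by positivity), mul_pow, Real.sq_sqrt hc]
    have := h x.ofLp
    rwa [dotProduct_self_eq_norm_sq, dotProduct_self_eq_norm_sq] at this
  calc ‖A‖ ^ 2 ≤ √c ^ 2 := pow_le_pow_left₀ (norm_nonneg _) hA 2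
    _ = c := Real.sq_sqrt hc

lemma dotProduct_sq_le {d : ℕ} (x y : Fin d → ℝ) : (x ⬝ᵥ y) ^ 2 ≤ (x ⬝ᵥ x) * (y ⬝ᵥ y) := by
  simpa [dotProduct, sq] using Finset.sum_mul_sq_le_sq_mul_sq Finset.univ x y

lemma dotProduct_mulVec_le {d : ℕ} (A : Matrix (Fin d) (Fin d) ℝ) (x : Fin d → ℝ) :
    x ⬝ᵥ (A *ᵥ x) ≤ ‖A‖ * (x ⬝ᵥ x) := by
  have hx : 0 ≤ x ⬝ᵥ x := by rw [dotProduct_self_eq_norm_sq]; positivity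
  refine abs_le_of_sq_le_sq' ?_ (by positivity) |>.2
  calc (x ⬝ᵥ (A *ᵥ x)) ^ 2 ≤ (x ⬝ᵥ x) * ((A *ᵥ x) ⬝ᵥ (A *ᵥ x)) := dotProduct_sq_le _ _
    _ ≤ (x ⬝ᵥ x) * (‖A‖ ^ 2 * (x ⬝ᵥ x)) :=
      mul_le_mul_of_nonneg_left (dotProduct_mulVec_self_le A x) hx
    _ = (‖A‖ * (x ⬝ᵥ x)) ^ 2 := by ring

lemma frobSq_nonneg {m n : ℕ} (A : Matrix (Fin m) (Fin n) ℝ) : 0 ≤ frobSq A :=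
  Finset.sum_nonneg fun _ _ => Finset.sum_nonneg fun _ _ => sq_nonneg _

lemma frob_nonneg {m n : ℕ} (A : Matrix (Fin m) (Fin n) ℝ) : 0 ≤ frob A := Real.sqrt_nonneg _

lemma frob_sq {m n : ℕ} (A : Matrix (Fin m) (Fin n) ℝ) : frob A ^ 2 = frobSq A :=
  Real.sq_sqrt (frobSq_nonneg A)

lemma frob_transpose {m n : ℕ} (A : Matrix (Fin m) (Fin n) ℝ) : frob Aᵀ = frob A := by
  unfold frob frobSq
  rw [Finset.sum_comm]
  rfl

lemma frob_eq_norm {m n : ℕ} (A : Matrix (Fin m) (Fin n) ℝ) :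
    frob A = ‖WithLp.toLp 2 (fun p : Fin m × Fin n => A p.1 p.2)‖ := by
  rw [EuclideanSpace.norm_eq, frob, frobSq, Fintype.sum_prod_type]
  simp

lemma frob_add_le {m n : ℕ} (A B : Matrix (Fin m) (Fin n) ℝ) :
    frob (A + B) ≤ frob A + frob B := by
  simp only [frob_eq_norm]
  exact norm_add_le (WithLp.toLp 2 (fun p : Fin m × Fin n => A p.1 p.2))
    (WithLp.toLp 2 (fun p : Fin m × Fin n => B p.1 p.2))

lemma frob_smul {m n : ℕ} (c : ℝ) (A : Matrix (Fin m) (Fin n) ℝ) :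
    frob (c • A) = |c| * frob A := by
  simp only [frob_eq_norm]
  exact norm_smul c (WithLp.toLp 2 (fun p : Fin m × Fin n => A p.1 p.2))

lemma frob_zero {m n : ℕ} : frob (0 : Matrix (Fin m) (Fin n) ℝ) = 0 := by
  simp [frob, frobSq]

lemma frob_sum_le {m n : ℕ} {ι : Type*} (s : Finset ι) (f : ι → Matrix (Fin m) (Fin n) ℝ) :
    frob (∑ i ∈ s, f i) ≤ ∑ i ∈ s, frob (f i) :=
  Finset.le_sum_of_subadditive frob frob_zero.le frob_add_le s f

lemma frobSq_mul_le {d : ℕ} (A B : Matrix (Fin d) (Fin d) ℝ) :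
    frobSq (A * B) ≤ ‖A‖ ^ 2 * frobSq B := by
  unfold frobSq
  rw [Finset.sum_comm, Finset.sum_comm (f := fun i j => B i j ^ 2), Finset.mul_sum]
  refine Finset.sum_le_sum fun j _ => ?_
  simpa [dotProduct, sq, mulVec, mul_apply] using dotProduct_mulVec_self_le A fun k => B k j

lemma frob_mul_le_norm_mul {d : ℕ} (A B : Matrix (Fin d) (Fin d) ℝ) :
    frob (A * B) ≤ ‖A‖ * frob B := by
  rw [← sq_le_sq₀ (frob_nonneg _) (mul_nonneg (norm_nonneg _) (frob_nonneg _)), mul_pow, frob_sq,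
    frob_sq]
  exact frobSq_mul_le A B

lemma frob_mul_le_mul_norm {d : ℕ} (A B : Matrix (Fin d) (Fin d) ℝ) :
    frob (A * B) ≤ frob A * ‖B‖ := by
  rw [← frob_transpose, transpose_mul, mul_comm, ← norm_transpose B, ← frob_transpose A]
  exact frob_mul_le_norm_mul _ _

lemma norm_le_frob {d : ℕ} (A : Matrix (Fin d) (Fin d) ℝ) : ‖A‖ ≤ frob A := by
  rw [← sq_le_sq₀ (norm_nonneg _) (frob_nonneg _), frob_sq]
  refine norm_sq_le_of_forall A (frobSq_nonneg A) fun x => ?_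
  rw [frobSq, Finset.sum_mul]
  refine Finset.sum_le_sum fun i _ => ?_
  simpa [dotProduct, mulVec, sq] using Finset.sum_mul_sq_le_sq_mul_sq Finset.univ (A i) x

lemma finner_eq_trace {m n : ℕ} (A B : Matrix (Fin m) (Fin n) ℝ) :
    finner A B = (Aᵀ * B).trace := by
  unfold finner
  rw [Finset.sum_comm]
  simp [trace, mul_apply]

lemma finner_self {m n : ℕ} (A : Matrix (Fin m) (Fin n) ℝ) : finner A A = frobSq A := by
  simp [finner, frobSq, sq]

lemma abs_finner_le {m n : ℕ} (A B : Matrix (Fin m) (Fin n) ℝ) :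
    |finner A B| ≤ frob A * frob B := by
  refine abs_le_of_sq_le_sq ?_ (mul_nonneg (frob_nonneg _) (frob_nonneg _))
  rw [mul_pow, frob_sq, frob_sq]
  simpa [finner, frobSq, Fintype.sum_prod_type] using
    Finset.sum_mul_sq_le_sq_mul_sq (Finset.univ : Finset (Fin m × Fin n))
      (fun p => A p.1 p.2) (fun p => B p.1 p.2)

lemma frobSq_add {m n : ℕ} (A B : Matrix (Fin m) (Fin n) ℝ) :
    frobSq (A + B) = frobSq A + 2 * finner A B + frobSq B := by
  simp only [frobSq, finner, Matrix.add_apply, Finset.mul_sum, ← Finset.sum_add_distrib]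
  refine Finset.sum_congr rfl fun i _ => Finset.sum_congr rfl fun j _ => ?_
  ring

lemma finner_sum_right {m n : ℕ} {ι : Type*} (s : Finset ι) (A : Matrix (Fin m) (Fin n) ℝ)
    (f : ι → Matrix (Fin m) (Fin n) ℝ) :
    finner A (∑ i ∈ s, f i) = ∑ i ∈ s, finner A (f i) := by
  simp only [finner_eq_trace, Matrix.mul_sum, trace_sum]

/-- Products of weights: peeling off the rightmost factor. -/
lemma seg_eq_seg_succ_mul {d : ℕ} (W : ℕ → Matrix (Fin d) (Fin d) ℝ) {m n : ℕ} (hm : 1 ≤ m)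
    (hmn : m ≤ n) : seg W m n = seg W (m + 1) n * W m := by
  induction n with
  | zero => omega
  | succ n ih =>
    rcases Nat.lt_or_ge n m with h | h
    · obtain rfl : m = n + 1 := by omega
      rcases n with _ | n
      · simp [seg]
      · simp [seg]
    · rw [seg, if_neg (by omega), seg, if_neg (by omega), ih h, Matrix.mul_assoc]

lemma seg_succ_self {d : ℕ} (W : ℕ → Matrix (Fin d) (Fin d) ℝ) (n : ℕ) : seg W (n + 1) n = 1 := by
  cases n <;> simp [seg]

lemma seg_succ {d : ℕ} (W : ℕ → Matrix (Fin d) (Fin d) ℝ) {m n : ℕ} (h : m ≤ n + 1) :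
    seg W m (n + 1) = W (n + 1) * seg W m n := by
  rw [seg, if_neg (by omega)]

lemma norm_seg_le {d : ℕ} (W : ℕ → Matrix (Fin d) (Fin d) ℝ) {β : ℝ} {L m n : ℕ} (hm : 1 ≤ m)
    (hmn : m ≤ n + 1) (hn : n ≤ L) (hβ : 0 ≤ β) (hW : ∀ l, 1 ≤ l → l ≤ L → ‖W l‖ ≤ β) :
    ‖seg W m n‖ ≤ β ^ (n + 1 - m) := by
  induction n with
  | zero =>
    obtain rfl : m = 1 := by omega
    simpa [seg] using norm_one_le
  | succ n ih =>
    rcases Nat.lt_or_ge (n + 1) m with h | h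
    · obtain rfl : m = n + 1 + 1 := by omega
      simpa [seg_succ_self] using norm_one_le
    · rw [seg_succ W h, show n + 1 + 1 - m = (n + 1 - m) + 1 by omega, pow_succ']
      exact (norm_mul_le _ _).trans (mul_le_mul (hW _ (by omega) hn) (ih h (by omega))
        (norm_nonneg _) hβ)

lemma seg_sub_seg {d : ℕ} (W V : ℕ → Matrix (Fin d) (Fin d) ℝ) (n : ℕ) :
    seg V 1 n - seg W 1 n =
      ∑ i ∈ Finset.range n, seg W (i + 2) n * (V (i + 1) - W (i + 1)) * seg V 1 i := by
  induction n with
  | zero => simp [seg]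
  | succ n ih =>
    rw [Finset.sum_range_succ, seg_succ_self, seg_succ V (by omega), seg_succ W (by omega)]
    have h : ∑ i ∈ Finset.range n, seg W (i + 2) (n + 1) * (V (i + 1) - W (i + 1)) * seg V 1 i
        = W (n + 1) * (seg V 1 n - seg W 1 n) := by
      rw [ih, Finset.mul_sum]
      refine Finset.sum_congr rfl fun i hi => ?_
      rw [Finset.mem_range] at hi
      rw [seg_succ W (by omega)]
      simp only [Matrix.mul_assoc]
    rw [h]
    noncomm_ring

lemma frob_seg_sub_seg_le {d : ℕ} (W V G : ℕ → Matrix (Fin d) (Fin d) ℝ) {η β : ℝ} {L n k : ℕ}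
    (hη : 0 ≤ η) (hβ : 1 ≤ β) (hV : ∀ l, 1 ≤ l → l ≤ L → V l = W l - η • G l)
    (hWβ : ∀ l, 1 ≤ l → l ≤ L → ‖W l‖ ≤ β) (hVβ : ∀ l, 1 ≤ l → l ≤ L → ‖V l‖ ≤ β)
    (hn : n ≤ L) (hk : n ≤ k + 1) :
    frob (seg V 1 n - seg W 1 n) ≤ η * β ^ k * ∑ j ∈ Finset.range L, frob (G (j + 1)) := by
  have hβ0 : 0 ≤ β := zero_le_one.trans hβ
  rw [seg_sub_seg]
  calc _ ≤ ∑ i ∈ Finset.range n, η * β ^ k * frob (G (i + 1)) := by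
        refine (frob_sum_le _ _).trans (Finset.sum_le_sum fun i hi => ?_)
        rw [Finset.mem_range] at hi
        have hVW : V (i + 1) - W (i + 1) = (-η) • G (i + 1) := by
          rw [hV _ (by omega) (by omega)]; simp
        rw [hVW]
        have h1 := norm_seg_le W (m := i + 2) (n := n) (by omega) (by omega) hn hβ0 hWβ
        have h2 := norm_seg_le V (m := 1) (n := i) le_rfl (by omega) (by omega) hβ0 hVβ
        calc _ ≤ frob (seg W (i + 2) n * (-η) • G (i + 1)) * ‖seg V 1 i‖ :=
              frob_mul_le_mul_norm _ _
          _ ≤ (‖seg W (i + 2) n‖ * frob ((-η) • G (i + 1))) * ‖seg V 1 i‖ :=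
              mul_le_mul_of_nonneg_right (frob_mul_le_norm_mul _ _) (norm_nonneg _)
          _ = (‖seg W (i + 2) n‖ * ‖seg V 1 i‖) * (η * frob (G (i + 1))) := by
              rw [frob_smul, abs_neg, abs_of_nonneg hη]; ring
          _ ≤ (β ^ (n + 1 - (i + 2)) * β ^ (i + 1 - 1)) * (η * frob (G (i + 1))) := by
              have := frob_nonneg (G (i + 1))
              gcongr
          _ ≤ β ^ k * (η * frob (G (i + 1))) := by
              have := frob_nonneg (G (i + 1))
              rw [← pow_add]
              gcongr
              omega
          _ = _ := by ring
    _ ≤ ∑ i ∈ Finset.range L, η * β ^ k * frob (G (i + 1)) :=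
        Finset.sum_le_sum_of_subset_of_nonneg (Finset.range_subset_range.2 hn) fun i _ _ =>
          mul_nonneg (by positivity) (frob_nonneg _)
    _ = _ := by rw [Finset.mul_sum]

lemma finner_mul_grad_mul {d : ℕ} (W : ℕ → Matrix (Fin d) (Fin d) ℝ)
    (Φ : Matrix (Fin d) (Fin d) ℝ) (L i : ℕ) :
    finner (seg W 1 L - Φ) (seg W (i + 2) L * grad W Φ L (i + 1) * seg W 1 i) =
      frobSq (grad W Φ L (i + 1)) := by
  rw [← finner_self, finner_eq_trace, finner_eq_trace]
  have h : (grad W Φ L (i + 1))ᵀ = seg W 1 i * ((seg W 1 L - Φ)ᵀ * seg W (i + 2) L) := by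
    simp [grad, transpose_mul]
  rw [h, Matrix.mul_assoc (seg W 1 i), trace_mul_comm (seg W 1 i)]
  simp only [Matrix.mul_assoc]

lemma loss_le_of_norm_le {d : ℕ} (W V : ℕ → Matrix (Fin d) (Fin d) ℝ)
    (Φ : Matrix (Fin d) (Fin d) ℝ) {η β : ℝ} {L : ℕ} (hL : 1 ≤ L)
    (hη : 0 ≤ η) (hβ : 1 ≤ β) (hV : ∀ l, 1 ≤ l → l ≤ L → V l = W l - η • grad W Φ L l)
    (hWβ : ∀ l, 1 ≤ l → l ≤ L → ‖W l‖ ≤ β) (hVβ : ∀ l, 1 ≤ l → l ≤ L → ‖V l‖ ≤ β) :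
    loss V Φ L ≤ loss W Φ L
      - η * (1 - η * L * frob (seg W 1 L - Φ) * β ^ (L - 1) - η * L * (β ^ (L - 1)) ^ 2 / 2)
        * ∑ i ∈ Finset.range L, frobSq (grad W Φ L (i + 1)) := by
  have hβ0 : 0 ≤ β := zero_le_one.trans hβ
  set E := seg W 1 L - Φ with hE
  set G := grad W Φ L with hG
  set S := ∑ i ∈ Finset.range L, frobSq (G (i + 1)) with hS
  set g := ∑ i ∈ Finset.range L, frob (G (i + 1)) with hg
  set M := β ^ (L - 1) with hM
  have hM0 : 0 ≤ M := by positivity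
  have hg0 : 0 ≤ g := Finset.sum_nonneg fun _ _ => frob_nonneg _
  have he0 : 0 ≤ frob E := frob_nonneg _
  have hgS : g ^ 2 ≤ L * S := by
    have := sq_sum_le_card_mul_sum_sq (s := Finset.range L) (f := fun i => frob (G (i + 1)))
    simpa [frob_sq] using this
  have hΔ : frob (seg V 1 L - seg W 1 L) ≤ η * M * g :=
    frob_seg_sub_seg_le W V G hη hβ hV hWβ hVβ le_rfl (by omega)
  have hΔ2 : frobSq (seg V 1 L - seg W 1 L) ≤ η ^ 2 * M ^ 2 * (L * S) := by
    rw [← frob_sq]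
    calc _ ≤ (η * M * g) ^ 2 := pow_le_pow_left₀ (frob_nonneg _) hΔ 2
      _ = η ^ 2 * M ^ 2 * g ^ 2 := by ring
      _ ≤ _ := by gcongr
  have hterm : ∀ i ∈ Finset.range L,
      finner E (seg W (i + 2) L * (V (i + 1) - W (i + 1)) * seg V 1 i) ≤
        -η * frobSq (G (i + 1)) + η ^ 2 * frob E * M * g * frob (G (i + 1)) := by
    intro i hi
    rw [Finset.mem_range] at hi
    set A := seg W (i + 2) L with hA
    have hVW : V (i + 1) - W (i + 1) = (-η) • G (i + 1) := by
      rw [hV _ (by omega) (by omega)]; simp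
    have hsplit : A * (V (i + 1) - W (i + 1)) * seg V 1 i =
        (-η) • (A * G (i + 1) * seg W 1 i)
          + (-η) • (A * G (i + 1) * (seg V 1 i - seg W 1 i)) := by
      rw [hVW, ← smul_add, ← Matrix.mul_add, add_sub_cancel, Matrix.mul_smul, Matrix.smul_mul]
    have hlin : ∀ X Y : Matrix (Fin d) (Fin d) ℝ,
        finner E ((-η) • X + (-η) • Y) = -η * finner E X + (-η) * finner E Y := by
      intro X Y
      simp [finner_eq_trace, Matrix.mul_add]
    rw [hsplit, hlin, finner_mul_grad_mul, neg_mul η (finner _ _)]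
    refine add_le_add_right ?_ _
    have hAn : ‖A‖ ≤ β ^ (L + 1 - (i + 2)) :=
      norm_seg_le W (m := i + 2) (n := L) (by omega) (by omega) le_rfl hβ0 hWβ
    have hBn : frob (seg V 1 i - seg W 1 i) ≤ η * β ^ i * g :=
      frob_seg_sub_seg_le W V G hη hβ hV hWβ hVβ hi.le (by omega)
    have hGi := frob_nonneg (G (i + 1))
    have hX : frob (A * G (i + 1) * (seg V 1 i - seg W 1 i)) ≤ η * M * g * frob (G (i + 1)) := by
      calc _ ≤ frob (A * G (i + 1)) * ‖seg V 1 i - seg W 1 i‖ := frob_mul_le_mul_norm _ _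
        _ ≤ (‖A‖ * frob (G (i + 1))) * frob (seg V 1 i - seg W 1 i) := by
            gcongr
            · exact frob_mul_le_norm_mul _ _
            · exact norm_le_frob _
        _ ≤ (β ^ (L + 1 - (i + 2)) * frob (G (i + 1))) * (η * β ^ i * g) := by
            have := frob_nonneg (seg V 1 i - seg W 1 i)
            gcongr
        _ = η * (β ^ (L + 1 - (i + 2)) * β ^ i) * g * frob (G (i + 1)) := by ring
        _ = _ := by rw [← pow_add, hM]; congr 5; omega
    calc _ ≤ |-(η * finner E (A * G (i + 1) * (seg V 1 i - seg W 1 i)))| := le_abs_self _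
      _ = η * |finner E (A * G (i + 1) * (seg V 1 i - seg W 1 i))| := by
          rw [abs_neg, abs_mul, abs_of_nonneg hη]
      _ ≤ η * (frob E * frob (A * G (i + 1) * (seg V 1 i - seg W 1 i))) := by
          gcongr; exact abs_finner_le _ _
      _ ≤ η * (frob E * (η * M * g * frob (G (i + 1)))) := by gcongr
      _ = _ := by ring
  have hinner : finner E (seg V 1 L - seg W 1 L) ≤ -η * S + η ^ 2 * frob E * M * (L * S) := by
    rw [seg_sub_seg, finner_sum_right]
    calc _ ≤ _ := Finset.sum_le_sum hterm
      _ = -η * S + η ^ 2 * frob E * M * g ^ 2 := by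
          rw [Finset.sum_add_distrib, ← Finset.mul_sum, ← Finset.mul_sum, ← hS, ← hg]; ring
      _ ≤ _ := by gcongr
  have hsum : seg V 1 L - Φ = E + (seg V 1 L - seg W 1 L) := by rw [hE]; abel
  rw [loss, loss, hsum, frobSq_add]
  linarith

/-- Powers of `1 + x / L` below the `L`-th are at most `exp x`. -/
lemma one_add_div_pow_le_exp {x : ℝ} (hx : 0 ≤ x) (L : ℕ) :
    (1 + x / L) ^ (L - 1) ≤ Real.exp x := by
  have h0 : 0 ≤ x / L := by positivity
  calc (1 + x / L) ^ (L - 1) ≤ Real.exp (x / L) ^ (L - 1) := by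
        gcongr
        linarith [Real.add_one_le_exp (x / L)]
    _ = Real.exp ((L - 1 : ℕ) * (x / L)) := by rw [← Real.exp_nat_mul]
    _ ≤ Real.exp x := by
        refine Real.exp_le_exp.2 ?_
        rcases Nat.eq_zero_or_pos L with rfl | hL
        · simpa using hx
        · have hL' : (0 : ℝ) < L := by exact_mod_cast hL
          have : ((L - 1 : ℕ) : ℝ) ≤ L := by exact_mod_cast Nat.sub_le _ _
          calc ((L - 1 : ℕ) : ℝ) * (x / L) ≤ L * (x / L) := by gcongr
            _ = x := by field_simp

lemma pow_le_of_mul_pow_le {L : ℕ} (hL : 2 ≤ L) {σ ε F : ℝ} (hσ : 0 ≤ σ)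
    (hε : ε ≤ (16 * (L : ℝ) ^ 3)⁻¹) (hε0 : 0 ≤ ε) (hF : 1 ≤ F)
    (h : σ * (1 + σ - L * ε) ^ (L - 1) ≤ F) :
    (1 + σ + L * ε) ^ (L - 1) ≤ 9 * L * F := by
  have hLr : (2 : ℝ) ≤ L := by exact_mod_cast hL
  have hL0 : (0 : ℝ) < L := by linarith
  have hLε : L * ε ≤ 1 / L / 32 := by
    calc L * ε ≤ L * (16 * (L : ℝ) ^ 3)⁻¹ := by gcongr
      _ = 1 / L * (1 / (16 * L)) := by field_simp
      _ ≤ 1 / L * (1 / (16 * 2)) := by gcongr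
      _ = _ := by ring
  have hinv : 1 / (L : ℝ) ≤ 1 / 2 := by gcongr
  have hinv0 : 0 < 1 / (L : ℝ) := by positivity
  have hLε0 : 0 ≤ L * ε := by positivity
  have he : Real.exp 1 ≤ 3 := by linarith [Real.exp_one_lt_d9]
  rcases le_total (1 / (L : ℝ)) σ with hc | hc
  · have hb : 0 ≤ 1 + σ - L * ε := by linarith
    calc (1 + σ + L * ε) ^ (L - 1) ≤ ((1 + 1 / L) * (1 + σ - L * ε)) ^ (L - 1) := by
          gcongr
          nlinarith
      _ = (1 + 1 / L) ^ (L - 1) * (1 + σ - L * ε) ^ (L - 1) := mul_pow _ _ _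
      _ ≤ 3 * (L * F) := by
          gcongr
          · exact (one_add_div_pow_le_exp zero_le_one L).trans he
          · have : 1 / L * (1 + σ - L * ε) ^ (L - 1) ≤ F :=
              (mul_le_mul_of_nonneg_right hc (by positivity)).trans h
            calc (1 + σ - L * ε) ^ (L - 1) = L * (1 / L * (1 + σ - L * ε) ^ (L - 1)) := by
                  field_simp
              _ ≤ L * F := by gcongr
      _ ≤ 9 * L * F := by nlinarith [mul_pos hL0 (zero_lt_one.trans_le hF)]
  · calc (1 + σ + L * ε) ^ (L - 1) ≤ (1 + 2 / L) ^ (L - 1) := by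
          have : 2 / (L : ℝ) = 1 / L + 1 / L := by ring
          exact pow_le_pow_left₀ (by linarith) (by linarith) _
      _ ≤ Real.exp 2 := one_add_div_pow_le_exp zero_le_two L
      _ = Real.exp 1 * Real.exp 1 := by rw [← Real.exp_add]; norm_num
      _ ≤ 3 * 3 := by gcongr
      _ ≤ 9 * L * F := by nlinarith

lemma dotProduct_self_nonneg {d : ℕ} (x : Fin d → ℝ) : 0 ≤ x ⬝ᵥ x := by
  rw [dotProduct_self_eq_norm_sq]; positivity

lemma dotProduct_mulVec_mulVec {d : ℕ} (A : Matrix (Fin d) (Fin d) ℝ) (x y : Fin d → ℝ) :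
    (A *ᵥ x) ⬝ᵥ y = x ⬝ᵥ (Aᵀ *ᵥ y) := by
  rw [dotProduct_mulVec, vecMul_transpose]

lemma dotProduct_Dmat_mulVec {d : ℕ} (W : ℕ → Matrix (Fin d) (Fin d) ℝ) (l : ℕ)
    (y : Fin d → ℝ) :
    y ⬝ᵥ (Dmat W l *ᵥ y) =
      (W (l + 1) *ᵥ y) ⬝ᵥ (W (l + 1) *ᵥ y) - ((W l)ᵀ *ᵥ y) ⬝ᵥ ((W l)ᵀ *ᵥ y) := by
  rw [Dmat, sub_mulVec, dotProduct_sub, dotProduct_mulVec_mulVec, dotProduct_mulVec_mulVec,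
    mulVec_mulVec, mulVec_mulVec, transpose_transpose]

/-- Applying `A` after `Aᵀ` expands at least as much as `Aᵀ` did. -/
lemma mul_dotProduct_le_of_transpose {d : ℕ} (A : Matrix (Fin d) (Fin d) ℝ) (x : Fin d → ℝ)
    {c : ℝ} (h : c * (x ⬝ᵥ x) ≤ (Aᵀ *ᵥ x) ⬝ᵥ (Aᵀ *ᵥ x)) :
    c * ((Aᵀ *ᵥ x) ⬝ᵥ (Aᵀ *ᵥ x)) ≤ (A *ᵥ (Aᵀ *ᵥ x)) ⬝ᵥ (A *ᵥ (Aᵀ *ᵥ x)) := by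
  set y := Aᵀ *ᵥ x with hy
  have hxy : x ⬝ᵥ (A *ᵥ y) = y ⬝ᵥ y := by
    rw [dotProduct_comm, dotProduct_mulVec_mulVec]
  have hcs := dotProduct_sq_le x (A *ᵥ y)
  rw [hxy] at hcs
  have hp := dotProduct_self_nonneg x
  have hq := dotProduct_self_nonneg y
  have hr := dotProduct_self_nonneg (A *ᵥ y)
  rcases hp.eq_or_lt with hp0 | hp0
  · rw [← hp0, zero_mul] at hcs
    have : y ⬝ᵥ y = 0 := pow_eq_zero_iff two_ne_zero |>.1 (le_antisymm hcs (sq_nonneg _))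
    rw [this, mul_zero]
    exact hr
  · refine le_of_mul_le_mul_left ?_ hp0
    nlinarith

/-- A lower bound on the end-to-end matrix in terms of the last layer, when the layers are
approximately balanced. -/
lemma mul_pow_le_norm_seg_sq {d : ℕ} (W : ℕ → Matrix (Fin d) (Fin d) ℝ) {L : ℕ} (hL : 2 ≤ L)
    {ε : ℝ} (hε0 : 0 ≤ ε) (hLε : L * ε ≤ 1)
    (hD : ∀ l, 1 ≤ l → l ≤ L - 2 → ‖Dmat W l‖ ≤ ε) (hD' : ‖1 + Dmat W (L - 1)‖ ≤ ε)
    (u : Fin d → ℝ) (hu : u ⬝ᵥ u = 1) :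
    ((W L)ᵀ *ᵥ u) ⬝ᵥ ((W L)ᵀ *ᵥ u) *
      (1 + ((W L)ᵀ *ᵥ u) ⬝ᵥ ((W L)ᵀ *ᵥ u) - L * ε) ^ (L - 1) ≤ ‖seg W 1 L‖ ^ 2 := by
  set σ := ((W L)ᵀ *ᵥ u) ⬝ᵥ ((W L)ᵀ *ᵥ u) with hσ
  have hσ0 : 0 ≤ σ := dotProduct_self_nonneg _
  set y : ℕ → Fin d → ℝ := fun j => (seg W (L - j + 1) L)ᵀ *ᵥ u with hy
  have hy_succ : ∀ j, j + 1 ≤ L → y (j + 1) = (W (L - j))ᵀ *ᵥ y j := by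
    intro j hj
    simp only [hy]
    rw [show L - (j + 1) + 1 = L - j by omega, seg_eq_seg_succ_mul W (by omega) (by omega),
      transpose_mul, mulVec_mulVec]
  have hy0 : y 0 = u := by simp [hy, seg_succ_self]
  have hy1 : y 1 = (W L)ᵀ *ᵥ u := by rw [hy_succ 0 (by omega), hy0, Nat.sub_zero]
  have hjε : ∀ j : ℕ, j ≤ L → (j : ℝ) * ε ≤ L * ε := fun j hj => by gcongr
  have hratio : ∀ j, j + 2 ≤ L →
      (1 + σ - (j + 1 : ℕ) * ε) * (y (j + 1) ⬝ᵥ y (j + 1)) ≤ y (j + 2) ⬝ᵥ y (j + 2) := by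
    intro j
    induction j with
    | zero =>
      intro _
      have hA : σ * (y 1 ⬝ᵥ y 1) ≤ (W L *ᵥ y 1) ⬝ᵥ (W L *ᵥ y 1) := by
        have := mul_dotProduct_le_of_transpose (W L) u (c := σ) (by rw [hu, mul_one])
        rwa [← hy1] at this
      have hB := dotProduct_Dmat_mulVec W (L - 1) (y 1)
      rw [show L - 1 + 1 = L by omega, ← hy_succ 1 (by omega)] at hB
      have hC := dotProduct_mulVec_le (1 + Dmat W (L - 1)) (y 1)
      rw [add_mulVec, one_mulVec, dotProduct_add, hB] at hC
      have hE := mul_le_mul_of_nonneg_right hD' (dotProduct_self_nonneg (y 1))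
      simp only [zero_add, Nat.cast_one]
      linarith
    | succ j ih =>
      intro hj
      have hA : (1 + σ - (j + 1 : ℕ) * ε) * (y (j + 2) ⬝ᵥ y (j + 2)) ≤
          (W (L - (j + 1)) *ᵥ y (j + 2)) ⬝ᵥ (W (L - (j + 1)) *ᵥ y (j + 2)) := by
        have hys := hy_succ (j + 1) (by omega)
        have := mul_dotProduct_le_of_transpose (W (L - (j + 1))) (y (j + 1))
          (c := 1 + σ - (j + 1 : ℕ) * ε) (by rw [← hys]; exact ih (by omega))
        rwa [← hys] at this
      have hB := dotProduct_Dmat_mulVec W (L - (j + 2)) (y (j + 2))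
      rw [show L - (j + 2) + 1 = L - (j + 1) by omega, ← hy_succ (j + 2) (by omega)] at hB
      have hC := dotProduct_mulVec_le (Dmat W (L - (j + 2))) (y (j + 2))
      have hE := mul_le_mul_of_nonneg_right (hD (L - (j + 2)) (by omega) (by omega))
        (dotProduct_self_nonneg (y (j + 2)))
      have hcast : ((j + 1 + 1 : ℕ) : ℝ) = (j + 1 : ℕ) + 1 := by push_cast; ring
      rw [hcast]
      show _ ≤ y (j + 2 + 1) ⬝ᵥ y (j + 2 + 1)
      show (1 + σ - ((j + 1 : ℕ) + 1 : ℝ) * ε) * (y (j + 2) ⬝ᵥ y (j + 2)) ≤ _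
      linarith
  have hchain : ∀ j, j + 1 ≤ L → σ * (1 + σ - L * ε) ^ j ≤ y (j + 1) ⬝ᵥ y (j + 1) := by
    intro j
    induction j with
    | zero => intro _; rw [pow_zero, mul_one, zero_add, hy1]
    | succ j ih =>
      intro hj
      have hb : 0 ≤ 1 + σ - L * ε := by linarith
      calc σ * (1 + σ - L * ε) ^ (j + 1) = (1 + σ - L * ε) * (σ * (1 + σ - L * ε) ^ j) := by ring
        _ ≤ (1 + σ - L * ε) * (y (j + 1) ⬝ᵥ y (j + 1)) := by
            gcongr; exact ih (by omega)
        _ ≤ (1 + σ - (j + 1 : ℕ) * ε) * (y (j + 1) ⬝ᵥ y (j + 1)) := by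
            refine mul_le_mul_of_nonneg_right ?_ (dotProduct_self_nonneg _)
            linarith [hjε (j + 1) (by omega)]
        _ ≤ _ := hratio j (by omega)
  have hfin := hchain (L - 1) (by omega)
  rw [show L - 1 + 1 = L by omega] at hfin
  refine hfin.trans ?_
  have := dotProduct_mulVec_self_le (seg W 1 L)ᵀ u
  rw [hu, mul_one, norm_transpose] at this
  simpa [hy] using this

lemma norm_sq_le_norm_succ_sq_add {d : ℕ} (W : ℕ → Matrix (Fin d) (Fin d) ℝ) (l : ℕ) :
    ‖W l‖ ^ 2 ≤ ‖W (l + 1)‖ ^ 2 + ‖Dmat W l‖ := by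
  rw [← norm_mul_transpose_self, ← norm_transpose_mul_self,
    show W l * (W l)ᵀ = (W (l + 1))ᵀ * W (l + 1) - Dmat W l by rw [Dmat]; abel]
  exact norm_sub_le _ _

lemma norm_sq_le_norm_last_sq_add {d : ℕ} (W : ℕ → Matrix (Fin d) (Fin d) ℝ) {L : ℕ}
    (hL : 2 ≤ L) {ε : ℝ} (hε0 : 0 ≤ ε)
    (hD : ∀ l, 1 ≤ l → l ≤ L - 2 → ‖Dmat W l‖ ≤ ε) (hD' : ‖1 + Dmat W (L - 1)‖ ≤ ε)
    {l : ℕ} (hl : 1 ≤ l) (hlL : l ≤ L) : ‖W l‖ ^ 2 ≤ 1 + ‖W L‖ ^ 2 + L * ε := by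
  have hlast : ‖W (L - 1)‖ ^ 2 ≤ 1 + ‖W L‖ ^ 2 + ε := by
    rw [← norm_mul_transpose_self, ← norm_transpose_mul_self]
    have h : W (L - 1) * (W (L - 1))ᵀ = 1 + (W L)ᵀ * W L - (1 + Dmat W (L - 1)) := by
      rw [Dmat, show L - 1 + 1 = L by omega]; abel
    rw [h]
    refine (norm_sub_le _ _).trans (add_le_add ((norm_add_le _ _).trans ?_) hD')
    exact add_le_add_left norm_one_le _
  have hdown : ∀ j, j + 2 ≤ L → ‖W (L - 1 - j)‖ ^ 2 ≤ 1 + ‖W L‖ ^ 2 + (j + 1 : ℕ) * ε := by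
    intro j
    induction j with
    | zero => intro _; simpa using hlast
    | succ j ih =>
      intro hj
      have h1 := norm_sq_le_norm_succ_sq_add W (L - 1 - (j + 1))
      rw [show L - 1 - (j + 1) + 1 = L - 1 - j by omega] at h1
      have h2 := hD (L - 1 - (j + 1)) (by omega) (by omega)
      have h3 := ih (by omega)
      push_cast at h3 ⊢
      linarith
  rcases hlL.eq_or_lt with rfl | hlt
  · have : 0 ≤ (l : ℝ) * ε := by positivity
    linarith
  · have h := hdown (L - 1 - l) (by omega)
    rw [show L - 1 - (L - 1 - l) = l by omega] at h
    refine h.trans ?_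
    gcongr
    omega

/-- Approximate balancedness and a bound on the end-to-end matrix bound every layer. -/
lemma norm_le_of_approx_balanced {d : ℕ} (W : ℕ → Matrix (Fin d) (Fin d) ℝ) {L : ℕ} (hL : 2 ≤ L)
    {ε φ b : ℝ} (hφ : 1 ≤ φ) (hε0 : 0 ≤ ε) (hε : ε ≤ (16 * (L : ℝ) ^ 3)⁻¹)
    (hD : ∀ l, 1 ≤ l → l ≤ L - 2 → ‖Dmat W l‖ ≤ ε) (hD' : ‖1 + Dmat W (L - 1)‖ ≤ ε)
    (hP : ‖seg W 1 L‖ ≤ φ) (hb0 : 0 ≤ b) (hb : b ^ (L - 1) = 3 * √L * φ) :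
    ∀ l, 1 ≤ l → l ≤ L → ‖W l‖ ≤ b := by
  have hLr : (2 : ℝ) ≤ L := by exact_mod_cast hL
  have hLε : L * ε ≤ 1 := by
    calc L * ε ≤ L * (16 * (L : ℝ) ^ 3)⁻¹ := by gcongr
      _ = 1 / (16 * L ^ 2) := by field_simp
      _ ≤ 1 := by rw [div_le_one (by positivity)]; nlinarith
  have hb2 : (b ^ 2) ^ (L - 1) = 9 * L * φ ^ 2 := by
    rw [← pow_mul, mul_comm, pow_mul, hb, mul_pow, mul_pow, Real.sq_sqrt (by positivity)]
    ring
  have hpow : ∀ s : ℝ, 0 ≤ s → (1 + s + L * ε) ^ (L - 1) ≤ 9 * L * φ ^ 2 →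
      1 + s + L * ε ≤ b ^ 2 := by
    intro s hs h
    rw [← hb2] at h
    exact (pow_le_pow_iff_left₀ (by positivity) (by positivity) (by omega)).1 h
  have hF : 1 ≤ φ ^ 2 := one_le_pow₀ hφ
  have hunit : ∀ u : Fin d → ℝ, u ⬝ᵥ u = 1 →
      1 + ((W L)ᵀ *ᵥ u) ⬝ᵥ ((W L)ᵀ *ᵥ u) + L * ε ≤ b ^ 2 := fun u hu =>
    hpow _ (dotProduct_self_nonneg _) <|
      pow_le_of_mul_pow_le hL (dotProduct_self_nonneg _) hε hε0 hF <|
        (mul_pow_le_norm_seg_sq W hL hε0 hLε hD hD' u hu).trans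
          (pow_le_pow_left₀ (norm_nonneg _) hP 2)
  have hbase : 1 + 0 + L * ε ≤ b ^ 2 :=
    hpow 0 le_rfl (pow_le_of_mul_pow_le hL le_rfl hε hε0 hF (by rw [zero_mul]; positivity))
  have hWL : ‖W L‖ ^ 2 ≤ b ^ 2 - 1 - L * ε := by
    rw [← norm_transpose]
    refine norm_sq_le_of_forall _ (by linarith) fun x => ?_
    rcases (dotProduct_self_nonneg x).eq_or_lt with h0 | hpos
    · have hx : x = 0 := dotProduct_self_eq_zero.1 h0.symm
      simp [hx]
    · set r := √(x ⬝ᵥ x) with hr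
      have hr0 : 0 < r := Real.sqrt_pos.2 hpos
      have hr2 : r ^ 2 = x ⬝ᵥ x := Real.sq_sqrt hpos.le
      have h := hunit (r⁻¹ • x) (by
        rw [smul_dotProduct, dotProduct_smul, ← hr2, smul_eq_mul, smul_eq_mul]
        field_simp)
      rw [mulVec_smul, smul_dotProduct, dotProduct_smul, smul_eq_mul, smul_eq_mul] at h
      rw [← hr2]
      calc _ = (r⁻¹ * (r⁻¹ * ((W L)ᵀ *ᵥ x ⬝ᵥ (W L)ᵀ *ᵥ x))) * r ^ 2 := by field_simp
        _ ≤ _ := by gcongr; linarith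
  intro l hl hlL
  rw [← sq_le_sq₀ (norm_nonneg _) hb0]
  linarith [norm_sq_le_norm_last_sq_add W hL hε0 hD hD' hl hlL]

lemma frob_grad_le {d : ℕ} (W : ℕ → Matrix (Fin d) (Fin d) ℝ) (Φ : Matrix (Fin d) (Fin d) ℝ)
    {L l : ℕ} {b : ℝ} (hb : 0 ≤ b) (hW : ∀ l, 1 ≤ l → l ≤ L → ‖W l‖ ≤ b) (hl : 1 ≤ l)
    (hlL : l ≤ L) : frob (grad W Φ L l) ≤ b ^ (L - 1) * frob (seg W 1 L - Φ) := by
  have h1 := norm_seg_le W (m := l + 1) (n := L) (by omega) (by omega) le_rfl hb hW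
  have h2 := norm_seg_le W (m := 1) (n := l - 1) le_rfl (by omega) (by omega) hb hW
  have he := frob_nonneg (seg W 1 L - Φ)
  calc frob (grad W Φ L l)
      ≤ (‖(seg W (l + 1) L)ᵀ‖ * frob (seg W 1 L - Φ)) * ‖(seg W 1 (l - 1))ᵀ‖ :=
        (frob_mul_le_mul_norm _ _).trans
          (mul_le_mul_of_nonneg_right (frob_mul_le_norm_mul _ _) (norm_nonneg _))
    _ ≤ (b ^ (L + 1 - (l + 1)) * frob (seg W 1 L - Φ)) * b ^ (l - 1 + 1 - 1) := by
        rw [norm_transpose, norm_transpose]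
        gcongr
    _ = (b ^ (L + 1 - (l + 1)) * b ^ (l - 1 + 1 - 1)) * frob (seg W 1 L - Φ) := by ring
    _ = _ := by rw [← pow_add]; congr 2; omega

/-- One gradient step decreases the loss, when the layers are approximately balanced. -/
lemma loss_step_le {d : ℕ} (W V : ℕ → Matrix (Fin d) (Fin d) ℝ) (Φ : Matrix (Fin d) (Fin d) ℝ)
    {L : ℕ} (hL : 2 ≤ L) {ε φ η : ℝ} (hφ : 1 ≤ φ) (hφΦ : 2 * frob Φ ≤ φ) (hη0 : 0 ≤ η)
    (hη : η ≤ (144 * (L : ℝ) ^ 2 * φ ^ 4)⁻¹) (hε0 : 0 ≤ ε) (hε : ε ≤ (16 * (L : ℝ) ^ 3)⁻¹)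
    (hD : ∀ l, 1 ≤ l → l ≤ L - 2 → ‖Dmat W l‖ ≤ ε) (hD' : ‖1 + Dmat W (L - 1)‖ ≤ ε)
    (hloss : loss W Φ L ≤ frobSq Φ / 2)
    (hV : ∀ l, 1 ≤ l → l ≤ L → V l = W l - η • grad W Φ L l) :
    loss V Φ L ≤ loss W Φ L - η / 2 * ∑ i ∈ Finset.range L, frobSq (grad W Φ L (i + 1)) := by
  have hLr : (2 : ℝ) ≤ L := by exact_mod_cast hL
  have hL0 : (0 : ℝ) < L := by linarith
  have hφ0 : 0 < φ := by linarith
  have hE : frob (seg W 1 L - Φ) ≤ φ / 2 := by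
    have h : frob (seg W 1 L - Φ) ≤ frob Φ := by
      rw [← sq_le_sq₀ (frob_nonneg _) (frob_nonneg _), frob_sq, frob_sq]
      rw [loss] at hloss
      linarith
    linarith
  have hP : ‖seg W 1 L‖ ≤ φ := by
    calc ‖seg W 1 L‖ ≤ frob ((seg W 1 L - Φ) + Φ) := by
          rw [sub_add_cancel]; exact norm_le_frob _
      _ ≤ frob (seg W 1 L - Φ) + frob Φ := frob_add_le _ _
      _ ≤ φ := by linarith
  set r := √(L : ℝ) with hr
  have hr2 : r ^ 2 = L := Real.sq_sqrt hL0.le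
  have hr0 : 0 ≤ r := Real.sqrt_nonneg _
  have hr1 : 1 ≤ r := by rw [hr]; exact Real.one_le_sqrt.2 (by linarith)
  have hrL : r ≤ L := by nlinarith
  have hη' : η * (L ^ 2 * φ ^ 4) ≤ 1 / 144 := by
    calc η * (L ^ 2 * φ ^ 4) ≤ (144 * (L : ℝ) ^ 2 * φ ^ 4)⁻¹ * (L ^ 2 * φ ^ 4) := by gcongr
      _ = 1 / 144 := by field_simp
  have hη2 : η * (L ^ 2 * φ ^ 2) ≤ 1 / 144 := by
    refine le_trans ?_ hη'
    gcongr
    norm_num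
  obtain ⟨b, hb0, hb⟩ : ∃ b : ℝ, 0 ≤ b ∧ b ^ (L - 1) = 3 * r * φ :=
    ⟨(3 * r * φ) ^ (((L - 1 : ℕ) : ℝ)⁻¹), by positivity,
      Real.rpow_inv_natCast_pow (by positivity) (by omega)⟩
  have hb1 : 1 ≤ b := by
    rw [← one_le_pow_iff_of_nonneg hb0 (n := L - 1) (by omega), hb]
    nlinarith
  have hWb := norm_le_of_approx_balanced W hL hφ hε0 hε hD hD' hP hb0 hb
  have hinv0 : 0 < 1 / (L : ℝ) := by positivity
  have hβ1 : 1 ≤ b * (1 + 1 / L) := by nlinarith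
  have hbβ : b + 1 / L ≤ b * (1 + 1 / L) := by nlinarith
  have hstep : ∀ l, 1 ≤ l → l ≤ L → η * frob (grad W Φ L l) ≤ 1 / L := by
    intro l hl hlL
    have hg := frob_grad_le W Φ hb0 hWb hl hlL
    rw [hb] at hg
    rw [le_div_iff₀ hL0]
    calc η * frob (grad W Φ L l) * L ≤ η * (3 * r * φ * (φ / 2)) * L := by
          gcongr
          exact hg.trans (by gcongr)
      _ ≤ η * (3 * L * φ * (φ / 2)) * L := by gcongr
      _ = 3 / 2 * (η * (L ^ 2 * φ ^ 2)) := by ring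
      _ ≤ 1 := by linarith
  have hVβ : ∀ l, 1 ≤ l → l ≤ L → ‖V l‖ ≤ b * (1 + 1 / L) := by
    intro l hl hlL
    rw [hV l hl hlL]
    calc ‖W l - η • grad W Φ L l‖ ≤ ‖W l‖ + ‖η • grad W Φ L l‖ := norm_sub_le _ _
      _ ≤ b + 1 / L := by
          refine add_le_add (hWb l hl hlL) ((norm_le_frob _).trans ?_)
          rw [frob_smul, abs_of_nonneg hη0]
          exact hstep l hl hlL
      _ ≤ _ := hbβ
  have hWβ : ∀ l, 1 ≤ l → l ≤ L → ‖W l‖ ≤ b * (1 + 1 / L) := fun l hl hlL =>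
    (hWb l hl hlL).trans (by linarith)
  have hβ : (b * (1 + 1 / L)) ^ (L - 1) ≤ 9 * r * φ := by
    rw [mul_pow, hb]
    have := (one_add_div_pow_le_exp zero_le_one L).trans Real.exp_one_lt_d9.le
    calc 3 * r * φ * (1 + 1 / (L : ℝ)) ^ (L - 1) ≤ 3 * r * φ * 3 := by
          gcongr; linarith
      _ = _ := by ring
  refine (loss_le_of_norm_le W V Φ (by omega) hη0 hβ1 hV hWβ hVβ).trans ?_
  have hS : 0 ≤ ∑ i ∈ Finset.range L, frobSq (grad W Φ L (i + 1)) :=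
    Finset.sum_nonneg fun _ _ => frobSq_nonneg _
  have hsecond : η * L * frob (seg W 1 L - Φ) * (b * (1 + 1 / L)) ^ (L - 1) ≤ 9 / 2 / 144 := by
    have he := frob_nonneg (seg W 1 L - Φ)
    calc _ ≤ η * L * (φ / 2) * (9 * L * φ) := by
          gcongr
          exact hβ.trans (by gcongr)
      _ = 9 / 2 * (η * (L ^ 2 * φ ^ 2)) := by ring
      _ ≤ _ := by linarith
  have hquad : η * L * ((b * (1 + 1 / L)) ^ (L - 1)) ^ 2 / 2 ≤ 81 / 2 / 144 := by
    calc _ ≤ η * L * (9 * r * φ) ^ 2 / 2 := by gcongr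
      _ = 81 / 2 * (η * (L * r ^ 2 * φ ^ 2)) := by ring
      _ = 81 / 2 * (η * (L ^ 2 * φ ^ 2)) := by rw [hr2]; ring
      _ ≤ _ := by linarith
  have hηS := mul_nonneg hη0 hS
  nlinarith

lemma transpose_mul_grad_succ {d : ℕ} (W : ℕ → Matrix (Fin d) (Fin d) ℝ)
    (Φ : Matrix (Fin d) (Fin d) ℝ) {L l : ℕ} (hl : 1 ≤ l) (hlL : l + 1 ≤ L) :
    (W (l + 1))ᵀ * grad W Φ L (l + 1) = grad W Φ L l * (W l)ᵀ := by
  have h1 := seg_eq_seg_succ_mul W (m := l + 1) (n := L) (by omega) hlL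
  have h2 : seg W 1 l = W l * seg W 1 (l - 1) := by
    have := seg_succ W (m := 1) (n := l - 1) (by omega)
    rwa [show l - 1 + 1 = l by omega] at this
  rw [grad, grad, Nat.add_sub_cancel, h2, h1]
  simp only [transpose_mul, Matrix.mul_assoc]

/-- Gradient descent changes the invariant matrices only at second order in the step size. -/
lemma Dmat_step {d : ℕ} (W V : ℕ → Matrix (Fin d) (Fin d) ℝ) (Φ : Matrix (Fin d) (Fin d) ℝ)
    {L l : ℕ} {η : ℝ} (hV : ∀ l, 1 ≤ l → l ≤ L → V l = W l - η • grad W Φ L l)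
    (hl : 1 ≤ l) (hlL : l + 1 ≤ L) :
    Dmat V l = Dmat W l + η ^ 2 • ((grad W Φ L (l + 1))ᵀ * grad W Φ L (l + 1)
      - grad W Φ L l * (grad W Φ L l)ᵀ) := by
  have h1 := transpose_mul_grad_succ W Φ hl hlL
  have h2 := congrArg transpose h1
  rw [transpose_mul, transpose_mul, transpose_transpose, transpose_transpose] at h2
  rw [Dmat, Dmat, hV l hl (by omega), hV (l + 1) (by omega) hlL]
  simp only [transpose_sub, transpose_smul, Matrix.sub_mul, Matrix.mul_sub, Matrix.smul_mul,
    Matrix.mul_smul, h1, h2]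
  module

lemma spec_Dmat_increment_le {d : ℕ} (W : ℕ → Matrix (Fin d) (Fin d) ℝ)
    (Φ : Matrix (Fin d) (Fin d) ℝ) {L l : ℕ} (η : ℝ) (hl : 1 ≤ l) (hlL : l + 1 ≤ L) :
    spec (η ^ 2 • ((grad W Φ L (l + 1))ᵀ * grad W Φ L (l + 1)
      - grad W Φ L l * (grad W Φ L l)ᵀ)) ≤
      η ^ 2 * ∑ i ∈ Finset.range L, frobSq (grad W Φ L (i + 1)) := by
  rw [spec_eq_norm, norm_smul, Real.norm_of_nonneg (sq_nonneg η)]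
  refine mul_le_mul_of_nonneg_left ?_ (sq_nonneg η)
  have hsq : ∀ A : Matrix (Fin d) (Fin d) ℝ, ‖A‖ ^ 2 ≤ frobSq A := fun A => by
    rw [← frob_sq]; exact pow_le_pow_left₀ (norm_nonneg _) (norm_le_frob A) 2
  calc _ ≤ ‖grad W Φ L (l + 1)‖ ^ 2 + ‖grad W Φ L l‖ ^ 2 := by
        refine (norm_sub_le _ _).trans ?_
        rw [norm_transpose_mul_self, norm_mul_transpose_self]
    _ ≤ frobSq (grad W Φ L (l + 1)) + frobSq (grad W Φ L (l - 1 + 1)) := by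
        rw [show l - 1 + 1 = l by omega]
        exact add_le_add (hsq _) (hsq _)
    _ = ∑ i ∈ {l, l - 1}, frobSq (grad W Φ L (i + 1)) := by
        rw [Finset.sum_pair (by omega)]
    _ ≤ _ := by
        refine Finset.sum_le_sum_of_subset_of_nonneg ?_ fun _ _ _ => frobSq_nonneg _
        intro i hi
        simp only [Finset.mem_insert, Finset.mem_singleton] at hi
        rw [Finset.mem_range]
        omega

lemma spec_add_le_of_le {d : ℕ} {A B : Matrix (Fin d) (Fin d) ℝ} {a b : ℝ} (hA : spec A ≤ a)
    (hB : spec B ≤ b) : spec (A + B) ≤ a + b :=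
  (norm_add_le A B).trans (add_le_add hA hB)

end

end ZAS

/-- along the discrete gradient descent trajectory from the ZAS
initialization with `η ≤ min{(4L³φ⁶)⁻¹, (144L²φ⁴)⁻¹}`, the approximate invariances
`‖D_l(t)‖₂ ≤ (2L³φ²)⁻¹` (for `l ≤ L-2`) and `‖I + D_{L-1}(t)‖₂ ≤ (4L²)⁻¹` hold for all `t`. -/
theorem discrete_gd_approximate_invariances
    (d L : ℕ) (hd : 1 ≤ d) (hL : 2 ≤ L)
    (Φ : Matrix (Fin d) (Fin d) ℝ) (η φ : ℝ)
    (hφ : φ = max (max (2 * frob Φ) (3 / Real.sqrt L)) 1)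
    (hη0 : 0 < η)
    (hη : η ≤ min (4 * (L:ℝ)^3 * φ^6)⁻¹ (144 * (L:ℝ)^2 * φ^4)⁻¹)
    (W : ℕ → ℕ → Matrix (Fin d) (Fin d) ℝ)
    (hupd : ∀ t : ℕ, ∀ l, 1 ≤ l → l ≤ L →
      W l (t+1) = W l t - η • grad (fun k => W k t) Φ L l)
    (hinit1 : ∀ l, 1 ≤ l → l ≤ L - 1 → W l 0 = 1)
    (hinitL : W L 0 = 0)
    (t : ℕ) :
    (∀ l, 1 ≤ l → l ≤ L - 2 →
      spec (Dmat (fun k => W k t) l) ≤ (2 * (L:ℝ)^3 * φ^2)⁻¹)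
    ∧ spec (1 + Dmat (fun k => W k t) (L-1)) ≤ (4 * (L:ℝ)^2)⁻¹ := by
  have hφ1 : 1 ≤ φ := hφ ▸ le_max_right _ _
  have hφΦ : 2 * frob Φ ≤ φ := by
    rw [hφ]; exact (le_max_left _ _).trans (le_max_left _ _)
  have hφ0 : 0 < φ := by linarith
  have hLr : (2 : ℝ) ≤ L := by exact_mod_cast hL
  have hL0 : (0 : ℝ) < L := by linarith
  have hη1 : η ≤ (4 * (L : ℝ) ^ 3 * φ ^ 6)⁻¹ := hη.trans (min_le_left _ _)
  have hη2 : η ≤ (144 * (L : ℝ) ^ 2 * φ ^ 4)⁻¹ := hη.trans (min_le_right _ _)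
  have hΦ : frobSq Φ ≤ φ ^ 2 / 4 := by
    have h := pow_le_pow_left₀ (mul_nonneg zero_le_two (frob_nonneg Φ)) hφΦ 2
    rw [mul_pow, frob_sq] at h
    linarith
  have hloss_nonneg : ∀ s, 0 ≤ loss (fun k => W k s) Φ L := fun s =>
    div_nonneg (frobSq_nonneg _) zero_le_two
  have hηΦ : η * frobSq Φ ≤ (16 * (L : ℝ) ^ 3 * φ ^ 4)⁻¹ := by
    calc η * frobSq Φ ≤ (4 * (L : ℝ) ^ 3 * φ ^ 6)⁻¹ * (φ ^ 2 / 4) := by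
          have := frobSq_nonneg Φ
          gcongr
      _ = _ := by field_simp; norm_num
  have hφ4 : 1 ≤ φ ^ 4 := one_le_pow₀ hφ1
  have hε : η * frobSq Φ ≤ (16 * (L : ℝ) ^ 3)⁻¹ := by
    refine hηΦ.trans (inv_anti₀ (by positivity) ?_)
    exact le_mul_of_one_le_right (by positivity) hφ4
  have hseg0 : seg (fun k => W k 0) 1 L = 0 := by
    obtain ⟨n, rfl⟩ : ∃ n, L = n + 1 := ⟨L - 1, by omega⟩
    rw [seg_succ _ (by omega), hinitL, Matrix.zero_mul]
  have hloss0 : loss (fun k => W k 0) Φ L = frobSq Φ / 2 := by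
    rw [loss, hseg0, zero_sub]
    simp [frobSq]
  have key : ∀ s, loss (fun k => W k s) Φ L ≤ frobSq Φ / 2 ∧
      (∀ l, 1 ≤ l → l ≤ L - 2 → spec (Dmat (fun k => W k s) l) ≤
        η * (frobSq Φ - 2 * loss (fun k => W k s) Φ L)) ∧
      spec (1 + Dmat (fun k => W k s) (L - 1)) ≤
        η * (frobSq Φ - 2 * loss (fun k => W k s) Φ L) := by
    intro s
    induction s with
    | zero =>
      have hz : η * (frobSq Φ - 2 * (frobSq Φ / 2)) = 0 := by ring
      rw [hloss0, hz]
      refine ⟨le_rfl, fun l hl hlL => ?_, ?_⟩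
      · rw [Dmat, hinit1 l hl (by omega), hinit1 (l + 1) (by omega) (by omega)]
        simp [spec]
      · rw [Dmat, show L - 1 + 1 = L by omega, hinitL, hinit1 (L - 1) (by omega) le_rfl]
        simp [spec]
    | succ s ih =>
      obtain ⟨ihl, ihD, ihD'⟩ := ih
      have hbound : η * (frobSq Φ - 2 * loss (fun k => W k s) Φ L) ≤ η * frobSq Φ := by
        have := hloss_nonneg s
        gcongr
        linarith
      have hdesc := loss_step_le (fun k => W k s) (fun k => W k (s + 1)) Φ hL hφ1 hφΦ hη0.le hη2
        (mul_nonneg hη0.le (frobSq_nonneg Φ)) hε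
        (fun l hl hlL => (ihD l hl hlL).trans hbound) (ihD'.trans hbound) ihl (hupd s)
      have hS : 0 ≤ ∑ i ∈ Finset.range L, frobSq (grad (fun k => W k s) Φ L (i + 1)) :=
        Finset.sum_nonneg fun _ _ => frobSq_nonneg _
      have hηS := mul_nonneg hη0.le hS
      have hacc : η * (frobSq Φ - 2 * loss (fun k => W k s) Φ L) +
          η ^ 2 * ∑ i ∈ Finset.range L, frobSq (grad (fun k => W k s) Φ L (i + 1)) ≤
          η * (frobSq Φ - 2 * loss (fun k => W k (s + 1)) Φ L) := by
        nlinarith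
      refine ⟨by linarith, fun l hl hlL => ?_, ?_⟩
      · rw [Dmat_step (fun k => W k s) (fun k => W k (s + 1)) Φ (hupd s) hl (by omega)]
        exact (spec_add_le_of_le (ihD l hl hlL)
          (spec_Dmat_increment_le _ Φ η hl (by omega))).trans hacc
      · rw [Dmat_step (fun k => W k s) (fun k => W k (s + 1)) Φ (hupd s) (by omega) (by omega),
          ← add_assoc]
        exact (spec_add_le_of_le ihD'
          (spec_Dmat_increment_le _ Φ η (by omega) (by omega))).trans hacc
  obtain ⟨-, hD, hD'⟩ := key t
  have hbound : η * (frobSq Φ - 2 * loss (fun k => W k t) Φ L) ≤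
      (16 * (L : ℝ) ^ 3 * φ ^ 4)⁻¹ := by
    refine le_trans ?_ hηΦ
    have := hloss_nonneg t
    gcongr
    linarith
  refine ⟨fun l hl hlL => (hD l hl hlL).trans (hbound.trans ?_), hD'.trans (hbound.trans ?_)⟩
  · refine inv_anti₀ (by positivity) ?_
    have : φ ^ 2 ≤ φ ^ 4 := pow_le_pow_right₀ hφ1 (by norm_num)
    gcongr
    norm_num
  · refine inv_anti₀ (by positivity) ?_
    calc 4 * (L : ℝ) ^ 2 ≤ 16 * (L : ℝ) ^ 3 := by nlinarith [sq_nonneg (L : ℝ)]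
      _ ≤ _ := le_mul_of_one_le_right (by positivity) hφ4
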